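/- If p and q are acyclic MLL proof nets and p ⇒m q (parallel elimination of a family of multiplicative cuts), then ln(q) ≤ φ(ln(p)), where φ : ℕ → ℕ is defined by φ(0) = 0 and φ(n) = n + (n+1)(φ(n−1)+2) for n > 0. -/

import Mathlib

/- Formalization of untyped MLL proof nets with jumps, switching paths,
   and parallel cut elimination, following Chouquet & Vaux Auclair. -/

namespace MLLNets

attribute [local instance] Classical.propDecidable

/-- Trees of MLL nets: variables (axiom conclusions, paired by the involution
    `(n,b) ↦ (n,!b)`), labelled units `1_λ`, labelled counits `⊥_μ`, and
    n-ary connectives `⊗`, `⅋`. -/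
inductive Tree : Type where
  | var : ℕ → Bool → Tree
  | unit : ℕ → Tree
  | counit : ℕ → Tree
  | tens : List Tree → Tree
  | parr : List Tree → Tree

instance : Inhabited Tree := ⟨Tree.unit 0⟩

/-- Atoms: variables, unit labels, counit labels. -/
inductive Atom : Type where
  | var : ℕ → Bool → Atom
  | unit : ℕ → Atom
  | counit : ℕ → Atom

namespace Tree

/-- Number of subtrees of a tree. -/
def size : Tree → ℕ
  | var _ _ => 1
  | unit _ => 1
  | counit _ => 1
  | tens ts => 1 + (ts.attach.map (fun x => x.1.size)).sum
  | parr ts => 1 + (ts.attach.map (fun x => x.1.size)).sum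
termination_by t => sizeOf t
decreasing_by all_goals (have h := List.sizeOf_lt_of_mem x.2; simp; omega)

/-- The set of subtrees of a tree. -/
noncomputable def ST : Tree → Finset Tree
  | var n b => {var n b}
  | unit l => {unit l}
  | counit l => {counit l}
  | tens ts => insert (tens ts) ((ts.attach.map (fun x => x.1.ST)).foldr (· ∪ ·) ∅)
  | parr ts => insert (parr ts) ((ts.attach.map (fun x => x.1.ST)).foldr (· ∪ ·) ∅)
termination_by t => sizeOf t
decreasing_by all_goals (have h := List.sizeOf_lt_of_mem x.2; simp; omega)

/-- The multiset of atoms occurring in a tree. -/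
def atoms : Tree → Multiset Atom
  | var n b => {Atom.var n b}
  | unit l => {Atom.unit l}
  | counit l => {Atom.counit l}
  | tens ts => (ts.attach.map (fun x => x.1.atoms)).sum
  | parr ts => (ts.attach.map (fun x => x.1.atoms)).sum
termination_by t => sizeOf t
decreasing_by all_goals (have h := List.sizeOf_lt_of_mem x.2; simp; omega)

/-- Substitution of the tree `s` for the variable `(n, b)`. -/
def subst (n : ℕ) (b : Bool) (s : Tree) : Tree → Tree
  | var m c => if m = n ∧ c = b then s else var m c
  | unit l => unit l
  | counit l => counit l
  | tens ts => tens (ts.attach.map (fun x => Tree.subst n b s x.1))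
  | parr ts => parr (ts.attach.map (fun x => Tree.subst n b s x.1))
termination_by t => sizeOf t
decreasing_by all_goals (have h := List.sizeOf_lt_of_mem x.2; simp; omega)

/-- Iterated substitution `t[t₁/x̄₁]⋯[tₙ/x̄ₙ]`: each list entry `((n,b), s)`
    records an axiom cut `⟨x|s⟩` with `x = (n,b)`, and `s` is substituted
    for `x̄ = (n, !b)`. -/
def substList (l : List ((ℕ × Bool) × Tree)) (t : Tree) : Tree :=
  l.foldl (fun u e => u.subst e.1.1 (!e.1.2) e.2) t

end Tree

/-- A (bare) proof net with a jump function: a finite set of cuts, a finite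
    family of conclusion trees, and a jump function assigning a tree to each
    counit label. -/
structure Net : Type where
  cuts : Finset (Tree × Tree)
  concl : List Tree
  jump : ℕ → Tree

namespace Net

/-- The subtrees of a net. -/
noncomputable def ST (p : Net) : Finset Tree :=
  (p.cuts.biUnion fun c => c.1.ST ∪ c.2.ST) ∪ (p.concl.map Tree.ST).foldr (· ∪ ·) ∅

/-- The multiset of atoms of a net. -/
def atoms (p : Net) : Multiset Atom :=
  (p.cuts.val.map fun c => c.1.atoms + c.2.atoms).sum + (p.concl.map Tree.atoms).sum

/-- The counit labels occurring in a net. -/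
noncomputable def counitLabels (p : Net) : Finset ℕ :=
  p.ST.biUnion fun t => match t with | Tree.counit l => {l} | _ => ∅

/-- The size of a net: its number of subtrees. -/
def size (p : Net) : ℕ :=
  (p.cuts.sum fun c => c.1.size + c.2.size) + (p.concl.map Tree.size).sum

/-- Well-formedness: each atom occurs at most once, connectives have arity
    ≥ 1, variables are closed under the involution, and jumps of counits
    occurring in the net are subtrees of the net. -/
def IsMLL (p : Net) : Prop :=
  p.atoms.Nodup ∧
  (∀ ts, Tree.tens ts ∈ p.ST → ts ≠ []) ∧
  (∀ ts, Tree.parr ts ∈ p.ST → ts ≠ []) ∧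
  (∀ n b, Atom.var n b ∈ p.atoms → Atom.var n (!b) ∈ p.atoms) ∧
  (∀ m, Tree.counit m ∈ p.ST → p.jump m ∈ p.ST)

end Net

/-- Edges of switching graphs: axiom edges, ⊗-edges (one per premise),
    ⅋-edges (one per ⅋-tree, its other endpoint chosen by the switching),
    jump edges and cut edges. -/
inductive Edge : Type where
  | ax : ℕ → Edge
  | tensE : Tree → Tree → Edge
  | parrE : Tree → Edge
  | jumpE : ℕ → Edge
  | cutE : Tree → Tree → Edge

/-- A switching chooses a premise of each ⅋-subtree. -/
def Net.IsSwitching (p : Net) (I : Tree → Tree) : Prop :=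
  ∀ ts, Tree.parr ts ∈ p.ST → I (Tree.parr ts) ∈ ts

/-- Adjacency in the switching graph of `p` determined by the switching `I`. -/
inductive Net.Adj (p : Net) (I : Tree → Tree) : Edge → Tree → Tree → Prop
  | ax (n : ℕ) : Tree.var n true ∈ p.ST → Tree.var n false ∈ p.ST →
      Net.Adj p I (Edge.ax n) (Tree.var n true) (Tree.var n false)
  | tens {ts t} : Tree.tens ts ∈ p.ST → t ∈ ts →
      Net.Adj p I (Edge.tensE (Tree.tens ts) t) (Tree.tens ts) t
  | parr {ts} : Tree.parr ts ∈ p.ST →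
      Net.Adj p I (Edge.parrE (Tree.parr ts)) (Tree.parr ts) (I (Tree.parr ts))
  | jump {m} : Tree.counit m ∈ p.ST →
      Net.Adj p I (Edge.jumpE m) (Tree.counit m) (p.jump m)
  | cut {t s} : (t, s) ∈ p.cuts → Net.Adj p I (Edge.cutE t s) t s
  | symm {e t u} : Net.Adj p I e t u → Net.Adj p I e u t

/-- `IsTrail p I t l` : `l` is a switching path (a sequence of pairwise
    distinct consecutive edges, each paired with the vertex it reaches)
    starting from the subtree `t`. -/
inductive Net.IsTrail (p : Net) (I : Tree → Tree) : Tree → List (Edge × Tree) → Prop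
  | nil (t) : t ∈ p.ST → Net.IsTrail p I t []
  | cons {t e u l} : Net.Adj p I e t u → Net.IsTrail p I u l → (∀ x ∈ l, x.1 ≠ e) →
      Net.IsTrail p I t ((e, u) :: l)

/-- `ln p` : the maximal length of a switching path of `p`. -/
noncomputable def Net.ln (p : Net) : ℕ :=
  sSup {n | ∃ I t l, p.IsSwitching I ∧ p.IsTrail I t l ∧ l.length = n}

/-- `jd p` : the maximal number of counit labels jumping to a common
    subtree of `p`. -/
noncomputable def Net.jd (p : Net) : ℕ :=
  p.ST.sup fun t => (p.counitLabels.filter fun m => p.jump m = t).card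

/-- A net is acyclic when no switching path visits the same subtree twice. -/
def Net.IsAcyclic (p : Net) : Prop :=
  ∀ I, p.IsSwitching I → ∀ t l, p.IsTrail I t l → (t :: l.map Prod.snd).Nodup

/-! ### Parallel cut elimination -/

/-- Cuts of `p` eliminated by the multiplicative family `F` (given by the
    lists of premises of the ⊗- and ⅋-trees of each cut). -/
noncomputable def melim (F : Finset (List Tree × List Tree)) : Finset (Tree × Tree) :=
  F.biUnion fun c => {(Tree.tens c.1, Tree.parr c.2), (Tree.parr c.2, Tree.tens c.1)}

/-- Residual cuts produced by the multiplicative family `F`. -/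
noncomputable def mres (F : Finset (List Tree × List Tree)) : Finset (Tree × Tree) :=
  F.biUnion fun c => (c.1.zip c.2).toFinset

/-- Cuts of `p` eliminated by an axiom family. -/
noncomputable def aelim (la : List ((ℕ × Bool) × Tree)) : Finset (Tree × Tree) :=
  la.foldr (fun e s =>
    insert (Tree.var e.1.1 e.1.2, e.2) (insert (e.2, Tree.var e.1.1 e.1.2) s)) ∅

/-- Cuts of `p` eliminated by an evanescent family (pairs `(λ, μ)` of a unit
    and a counit label). -/
noncomputable def eelim (le : List (ℕ × ℕ)) : Finset (Tree × Tree) :=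
  le.foldr (fun e s =>
    insert (Tree.unit e.1, Tree.counit e.2) (insert (Tree.counit e.2, Tree.unit e.1) s)) ∅

/-- The redirection function `ρ` for the parallel elimination of evanescent
    cuts: `Rho p le j t` holds when the jump of the `j`-th eliminated
    counit, followed along the chain of eliminated evanescent cuts, ends
    at the tree `t`. -/
inductive Rho (p : Net) (le : List (ℕ × ℕ)) : ℕ → Tree → Prop
  | base (j : ℕ) :
      (∀ i < j, p.jump ((le.getD j (0,0)).2) ≠ Tree.counit ((le.getD i (0,0)).2) ∧
                p.jump ((le.getD j (0,0)).2) ≠ Tree.unit ((le.getD i (0,0)).1)) →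
      Rho p le j (p.jump ((le.getD j (0,0)).2))
  | step {i j : ℕ} {t : Tree} : i < j →
      (p.jump ((le.getD j (0,0)).2) = Tree.counit ((le.getD i (0,0)).2) ∨
       p.jump ((le.getD j (0,0)).2) = Tree.unit ((le.getD i (0,0)).1)) →
      Rho p le i t → Rho p le j t

/-- `ParStepF p q F la le` : `q` is obtained from `p` by the simultaneous
    elimination of the family `F` of multiplicative cuts, the family `la` of
    axiom cuts and the family `le` of evanescent cuts. -/
structure ParStepF (p q : Net) (F : Finset (List Tree × List Tree))
    (la : List ((ℕ × Bool) × Tree)) (le : List (ℕ × ℕ)) : Prop where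
  /-- each member of `F` is a multiplicative cut of `p` -/
  hF : ∀ c ∈ F, c.1.length = c.2.length ∧ c.1 ≠ [] ∧
       ((Tree.tens c.1, Tree.parr c.2) ∈ p.cuts ∨ (Tree.parr c.2, Tree.tens c.1) ∈ p.cuts)
  /-- each member of `la` is an axiom cut of `p` -/
  ha : ∀ e ∈ la, (Tree.var e.1.1 e.1.2, e.2) ∈ p.cuts ∨ (e.2, Tree.var e.1.1 e.1.2) ∈ p.cuts
  haN : (la.map Prod.fst).Nodup
  /-- `x̄ᵢ ∉ {x₁, …, xₙ}` -/
  haBar : ∀ e ∈ la, (e.1.1, !e.1.2) ∉ la.map Prod.fst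
  /-- `x̄ᵢ` does not occur in `tⱼ` for `i ≤ j` -/
  haFv : ∀ i j, i ≤ j → j < la.length →
      Atom.var (la.getD i default).1.1 (!(la.getD i default).1.2) ∉ (la.getD j default).2.atoms
  /-- each member of `le` is a cut of `p` between a unit and a counit -/
  he : ∀ e ∈ le, (Tree.unit e.1, Tree.counit e.2) ∈ p.cuts ∨ (Tree.counit e.2, Tree.unit e.1) ∈ p.cuts
  heN : (le.map Prod.snd).Nodup
  /-- `jump(μᵢ) ∉ {⊥_{μⱼ}, 1_{λⱼ}}` for `i ≤ j` (in particular each eliminated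
      evanescent cut is reducible) -/
  heJ : ∀ i j, i ≤ j → j < le.length →
      p.jump ((le.getD i (0,0)).2) ≠ Tree.counit ((le.getD j (0,0)).2) ∧
      p.jump ((le.getD i (0,0)).2) ≠ Tree.unit ((le.getD j (0,0)).1)
  /-- the cuts of `q`: the remaining cuts plus the multiplicative residuals,
      under the substitution generated by the axiom cuts -/
  hcuts : q.cuts = ((p.cuts \ (melim F ∪ aelim la ∪ eelim le)) ∪ mres F).image
      (fun c => (Tree.substList la c.1, Tree.substList la c.2))
  /-- the conclusions of `q` -/
  hconcl : q.concl = p.concl.map (Tree.substList la)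
  /-- the jump function of `q`, with redirections -/
  hjump : ∀ m, Tree.counit m ∈ q.ST →
      (∃ c ∈ F, p.jump m = Tree.tens c.1 ∧ q.jump m = Tree.substList la c.1.headI) ∨
      (∃ c ∈ F, p.jump m = Tree.parr c.2 ∧ q.jump m = Tree.substList la c.2.headI) ∨
      (∃ i < la.length,
        (p.jump m = Tree.var (la.getD i default).1.1 (la.getD i default).1.2 ∨
         p.jump m = Tree.var (la.getD i default).1.1 (!(la.getD i default).1.2)) ∧
        q.jump m = Tree.substList (la.drop (i+1)) (la.getD i default).2) ∨
      (∃ i < le.length,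
        (p.jump m = Tree.counit ((le.getD i (0,0)).2) ∨
         p.jump m = Tree.unit ((le.getD i (0,0)).1)) ∧
        ∃ t, Rho p le i t ∧ q.jump m = Tree.substList la t) ∨
      ((∀ c ∈ F, p.jump m ≠ Tree.tens c.1 ∧ p.jump m ≠ Tree.parr c.2) ∧
       (∀ e ∈ la, p.jump m ≠ Tree.var e.1.1 e.1.2 ∧ p.jump m ≠ Tree.var e.1.1 (!e.1.2)) ∧
       (∀ e ∈ le, p.jump m ≠ Tree.counit e.2 ∧ p.jump m ≠ Tree.unit e.1) ∧
       q.jump m = Tree.substList la (p.jump m))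

/-- Parallel elimination of a family of multiplicative cuts (`p ⇒m q`). -/
def MultStep (p q : Net) : Prop := ∃ F, ParStepF p q F [] []

/-- Parallel elimination of a family of axiom cuts (`p ⇒a q`). -/
def AxStep (p q : Net) : Prop := ∃ la, ParStepF p q ∅ la []

/-- Parallel elimination of a family of evanescent cuts (`p ⇒e q`). -/
def EvStep (p q : Net) : Prop := ∃ le, ParStepF p q ∅ [] le

/-- A parallel cut elimination step (`p ⇒ q`), eliminating an arbitrary
    family of reducible cuts of the three kinds. -/
def ParStep (p q : Net) : Prop := ∃ F la le, ParStepF p q F la le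

/-- Elimination of a single reducible cut. -/
def Step1 (p q : Net) : Prop :=
  (∃ c, ParStepF p q {c} [] []) ∨ (∃ e, ParStepF p q ∅ [e] []) ∨ (∃ e, ParStepF p q ∅ [] [e])

/-- `k` parallel cut elimination steps. -/
def ParStepN : ℕ → Net → Net → Prop
  | 0, p, q => p = q
  | k+1, p, q => ∃ r, ParStep p r ∧ ParStepN k r q

/-! ### Evanescent cuts and the sets `Iⁿ(t)` -/

/-- `p.IsEvCut l m` : `⟨1_l | ⊥_m⟩` is a reducible evanescent cut of `p`. -/
def Net.IsEvCut (p : Net) (l m : ℕ) : Prop :=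
  ((Tree.unit l, Tree.counit m) ∈ p.cuts ∨ (Tree.counit m, Tree.unit l) ∈ p.cuts) ∧
  p.jump m ≠ Tree.unit l ∧ p.jump m ≠ Tree.counit m

/-- The sets `Iⁿ(t)` of counit labels reaching `t` through a chain of `n`
    evanescent cuts. -/
noncomputable def Net.Iset (p : Net) (t : Tree) : ℕ → Finset ℕ
  | 0 => p.counitLabels.filter fun m => p.jump m = t
  | n+1 => p.counitLabels.filter fun m' =>
      ∃ l m, p.IsEvCut l m ∧ m ∈ p.Iset t n ∧
        (p.jump m' = Tree.counit m ∨ p.jump m' = Tree.unit l)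

/-- The number of evanescent cuts of `p`. -/
noncomputable def Net.evCutCount (p : Net) : ℕ :=
  (p.cuts.filter fun c => ∃ l m,
    (c = (Tree.unit l, Tree.counit m) ∨ c = (Tree.counit m, Tree.unit l)) ∧
    p.jump m ≠ Tree.unit l ∧ p.jump m ≠ Tree.counit m).card

/-! ### The function φ -/

/-- `φ(0) = 0` and `φ(n) = n + (n+1)(φ(n-1)+2)` for `n > 0`. -/
def phi : ℕ → ℕ
  | 0 => 0
  | n + 1 => (n + 1) + (n + 2) * (phi n + 2)

/-! ### Residual edges, slipknots, bridges and bounces -/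

/-- The residual cut edges in `q` of an eliminated multiplicative cut. -/
noncomputable def resEdges (c : List Tree × List Tree) : Finset Edge :=
  ((c.1.zip c.2).map fun d => Edge.cutE d.1 d.2).toFinset

/-- Canonical form of a `c`-bridge: a path bound to `c` crossing its cut edge. -/
def IsBridgeCan (c : List Tree × List Tree) (b : List Edge) : Prop :=
  ∃ pre post : List Edge,
    (pre = [] ∨ ∃ t ∈ c.1, pre = [Edge.tensE (Tree.tens c.1) t]) ∧
    (post = [] ∨ post = [Edge.parrE (Tree.parr c.2)]) ∧
    (b = pre ++ Edge.cutE (Tree.tens c.1) (Tree.parr c.2) :: post ∨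
     b = pre ++ Edge.cutE (Tree.parr c.2) (Tree.tens c.1) :: post)

/-- A `c`-bridge, in either direction. -/
def IsBridge (c : List Tree × List Tree) (b : List Edge) : Prop :=
  IsBridgeCan c b ∨ IsBridgeCan c b.reverse

/-- A `c`-bounce: a path bound to `c`, not crossing its cut edge, and
    visiting its ⊗-tree. -/
def IsBounce (c : List Tree × List Tree) (b : List Edge) : Prop :=
  b = [] ∨ (∃ t ∈ c.1, b = [Edge.tensE (Tree.tens c.1) t]) ∨
  (∃ t ∈ c.1, ∃ t' ∈ c.1, t ≠ t' ∧
    b = [Edge.tensE (Tree.tens c.1) t, Edge.tensE (Tree.tens c.1) t'])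

/-- `Gen F es es'` : the edge sequence `es'` (in `p`) is generated by the
    straight edge sequence `es` (in `q`): preserved edges are kept, and each
    residual cut edge is replaced by a bridge of the corresponding
    eliminated cut. -/
inductive Gen (F : Finset (List Tree × List Tree)) : List Edge → List Edge → Prop
  | nil : Gen F [] []
  | pres {e l l'} : (∀ c ∈ F, e ∉ resEdges c) → Gen F l l' → Gen F (e :: l) (e :: l')
  | res {c d l l' b} : c ∈ F → d ∈ resEdges c → IsBridge c b → Gen F l l' →
      Gen F (d :: l) (b ++ l')

/-- A straight path: a path with no slipknot, i.e. crossing at most one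
    residual of each eliminated cut. -/
def Straight (F : Finset (List Tree × List Tree)) (l : List (Edge × Tree)) : Prop :=
  ¬ ∃ c ∈ F, ∃ l₁ l₂ l₃ : List (Edge × Tree), ∃ d v d' v',
      d ∈ resEdges c ∧ d' ∈ resEdges c ∧ l = l₁ ++ (d, v) :: l₂ ++ (d', v') :: l₃

/-- Independent paths: disjoint, and crossing residuals of no common
    eliminated cut. -/
def Indep (F : Finset (List Tree × List Tree)) (l₁ l₂ : List (Edge × Tree)) : Prop :=
  (∀ x ∈ l₁, ∀ y ∈ l₂, x.1 ≠ y.1) ∧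
  ¬ ∃ c ∈ F, (∃ x ∈ l₁, x.1 ∈ resEdges c) ∧ (∃ y ∈ l₂, y.1 ∈ resEdges c)

/-- `DecompWith F l cs χs ξs` : the decomposition `l = χ₁ξ₁⋯χₙξₙχₙ₊₁` of a
    path of `q` into pairwise independent straight paths `χᵢ` and slipknots
    `ξᵢ` on the pairwise distinct eliminated cuts `cs = c₁, …, cₙ`. -/
def DecompWith (F : Finset (List Tree × List Tree)) (l : List (Edge × Tree))
    (cs : List (List Tree × List Tree)) (χs ξs : List (List (Edge × Tree))) : Prop :=
  cs.Nodup ∧ (∀ c ∈ cs, c ∈ F) ∧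
  χs.length = cs.length + 1 ∧ ξs.length = cs.length ∧
  l = (List.zipWith (· ++ ·) χs (ξs ++ [[]])).flatten ∧
  (∀ x ∈ χs, Straight F x ∧ ∀ c ∈ cs, ∀ y ∈ x, y.1 ∉ resEdges c) ∧
  χs.Pairwise (Indep F) ∧
  List.Forall₂ (fun (ξ : List (Edge × Tree)) (c : List Tree × List Tree) =>
      ∃ t s t' s' mid, (t, s) ∈ c.1.zip c.2 ∧ (t', s') ∈ c.1.zip c.2 ∧ t ≠ t' ∧
        ξ = (Edge.cutE t s, s) :: mid ++ [(Edge.cutE t' s', t')]) ξs cs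

/-- `Decomp F l cs` : some decomposition of `l` along the cut sequence `cs`
    exists. -/
def Decomp (F : Finset (List Tree × List Tree)) (l : List (Edge × Tree))
    (cs : List (List Tree × List Tree)) : Prop :=
  ∃ χs ξs, DecompWith F l cs χs ξs

/-! ### α-equivalence -/

/-- A renaming of atoms: a map on variable names together with a possible
    flip of polarities (so as to commute with the involution), a map on unit
    labels and a map on counit labels. -/
structure Ren : Type where
  v : ℕ → ℕ
  vb : ℕ → Bool
  u : ℕ → ℕ
  c : ℕ → ℕ

/-- Applying a renaming to a tree. -/
def Tree.rename (r : Ren) : Tree → Tree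
  | Tree.var n b => Tree.var (r.v n) (xor b (r.vb n))
  | Tree.unit l => Tree.unit (r.u l)
  | Tree.counit l => Tree.counit (r.c l)
  | Tree.tens ts => Tree.tens (ts.attach.map (fun x => Tree.rename r x.1))
  | Tree.parr ts => Tree.parr (ts.attach.map (fun x => Tree.rename r x.1))
termination_by t => sizeOf t
decreasing_by all_goals (have h := List.sizeOf_lt_of_mem x.2; simp; omega)

/-- α-equivalence of nets: renaming of atoms (preserving the involution on
    variables) and reindexing of cuts. -/
def AlphaEq (p q : Net) : Prop :=
  ∃ r : Ren, Function.Bijective r.v ∧ Function.Bijective r.u ∧ Function.Bijective r.c ∧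
    q.cuts = p.cuts.image (fun c => (c.1.rename r, c.2.rename r)) ∧
    q.concl = p.concl.map (Tree.rename r) ∧
    (∀ m, Tree.counit m ∈ p.ST → q.jump (r.c m) = (p.jump m).rename r)

end MLLNets
namespace MLLNets

open MLLNets.Tree

attribute [local instance] Classical.propDecidable

/-! ### Subtrees and atoms -/

theorem mem_foldr_union {α β : Type*} [DecidableEq β] (f : α → Finset β) (l : List α) (x : β) :
    x ∈ (l.map f).foldr (· ∪ ·) ∅ ↔ ∃ a ∈ l, x ∈ f a := by
  induction l with
  | nil => simp
  | cons a l ih => simp [ih]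

namespace Tree

theorem mem_ST_tens {ts : List Tree} {x : Tree} :
    x ∈ (tens ts).ST ↔ x = tens ts ∨ ∃ t ∈ ts, x ∈ t.ST := by
  rw [ST, Finset.mem_insert, mem_foldr_union (fun y : {y // y ∈ ts} => y.1.ST)]
  simp

theorem mem_ST_parr {ts : List Tree} {x : Tree} :
    x ∈ (parr ts).ST ↔ x = parr ts ∨ ∃ t ∈ ts, x ∈ t.ST := by
  rw [ST, Finset.mem_insert, mem_foldr_union (fun y : {y // y ∈ ts} => y.1.ST)]
  simp

theorem mem_ST_self (t : Tree) : t ∈ t.ST := by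
  cases t <;> simp [ST]

theorem atoms_tens (ts : List Tree) : (tens ts).atoms = (ts.map atoms).sum := by
  simp [atoms]

theorem atoms_parr (ts : List Tree) : (parr ts).atoms = (ts.map atoms).sum := by
  simp [atoms]

theorem mem_sum_atoms {ts : List Tree} {a : Atom} :
    a ∈ (ts.map atoms).sum ↔ ∃ t ∈ ts, a ∈ t.atoms := by
  induction ts with
  | nil => simp
  | cons t ts ih => simp [ih]

/-- Induction on trees with the induction hypothesis available for all premises. -/
theorem premise_induction {motive : Tree → Prop} (var : ∀ n b, motive (var n b))
    (unit : ∀ l, motive (unit l)) (counit : ∀ l, motive (counit l))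
    (tens : ∀ ts, (∀ t ∈ ts, motive t) → motive (tens ts))
    (parr : ∀ ts, (∀ t ∈ ts, motive t) → motive (parr ts)) : ∀ t, motive t
  | .var n b => var n b
  | .unit l => unit l
  | .counit l => counit l
  | .tens ts => tens ts fun t _ => premise_induction var unit counit tens parr t
  | .parr ts => parr ts fun t _ => premise_induction var unit counit tens parr t
termination_by t => sizeOf t
decreasing_by all_goals (have h := List.sizeOf_lt_of_mem ‹_ ∈ ts›; simp; omega)

theorem ST_trans {x y : Tree} (hxy : x ∈ y.ST) (z : Tree) : y ∈ z.ST → x ∈ z.ST := by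
  induction z using premise_induction with
  | var n b => intro h; simp only [ST, Finset.mem_singleton] at h; subst h; exact hxy
  | unit n => intro h; simp only [ST, Finset.mem_singleton] at h; subst h; exact hxy
  | counit n => intro h; simp only [ST, Finset.mem_singleton] at h; subst h; exact hxy
  | tens ts ih =>
    intro h
    rcases mem_ST_tens.1 h with rfl | ⟨t, ht, h⟩
    · exact hxy
    · exact mem_ST_tens.2 (.inr ⟨t, ht, ih t ht h⟩)
  | parr ts ih =>
    intro h
    rcases mem_ST_parr.1 h with rfl | ⟨t, ht, h⟩
    · exact hxy
    · exact mem_ST_parr.2 (.inr ⟨t, ht, ih t ht h⟩)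

theorem ST_premise_tens {ts : List Tree} {t : Tree} (h : t ∈ ts) : t ∈ (tens ts).ST :=
  mem_ST_tens.2 (.inr ⟨t, h, mem_ST_self t⟩)

theorem ST_premise_parr {ts : List Tree} {t : Tree} (h : t ∈ ts) : t ∈ (parr ts).ST :=
  mem_ST_parr.2 (.inr ⟨t, h, mem_ST_self t⟩)

theorem sizeOf_le_of_mem_ST {x : Tree} (z : Tree) : x ∈ z.ST → sizeOf x ≤ sizeOf z := by
  induction z using premise_induction with
  | var n b => intro h; simp only [ST, Finset.mem_singleton] at h; subst h; rfl
  | unit n => intro h; simp only [ST, Finset.mem_singleton] at h; subst h; rfl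
  | counit n => intro h; simp only [ST, Finset.mem_singleton] at h; subst h; rfl
  | tens ts ih =>
    intro h
    rcases mem_ST_tens.1 h with rfl | ⟨t, ht, h⟩
    · rfl
    · have := List.sizeOf_lt_of_mem ht
      have := ih t ht h
      simp only [tens.sizeOf_spec]; omega
  | parr ts ih =>
    intro h
    rcases mem_ST_parr.1 h with rfl | ⟨t, ht, h⟩
    · rfl
    · have := List.sizeOf_lt_of_mem ht
      have := ih t ht h
      simp only [parr.sizeOf_spec]; omega

theorem tens_notMem_ST_premise {ts : List Tree} {t : Tree} (h : t ∈ ts) : tens ts ∉ t.ST := by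
  intro h'
  have h1 := sizeOf_le_of_mem_ST _ h'
  have h2 := List.sizeOf_lt_of_mem h
  simp only [tens.sizeOf_spec] at h1; omega

theorem parr_notMem_ST_premise {ts : List Tree} {t : Tree} (h : t ∈ ts) : parr ts ∉ t.ST := by
  intro h'
  have h1 := sizeOf_le_of_mem_ST _ h'
  have h2 := List.sizeOf_lt_of_mem h
  simp only [parr.sizeOf_spec] at h1; omega

theorem atoms_subset_of_mem_ST {x : Tree} {a : Atom} (ha : a ∈ x.atoms) (z : Tree) :
    x ∈ z.ST → a ∈ z.atoms := by
  induction z using premise_induction with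
  | var n b => intro h; simp only [ST, Finset.mem_singleton] at h; subst h; exact ha
  | unit n => intro h; simp only [ST, Finset.mem_singleton] at h; subst h; exact ha
  | counit n => intro h; simp only [ST, Finset.mem_singleton] at h; subst h; exact ha
  | tens ts ih =>
    intro h
    rcases mem_ST_tens.1 h with rfl | ⟨t, ht, h⟩
    · exact ha
    · rw [atoms_tens, mem_sum_atoms]; exact ⟨t, ht, ih t ht h⟩
  | parr ts ih =>
    intro h
    rcases mem_ST_parr.1 h with rfl | ⟨t, ht, h⟩
    · exact ha
    · rw [atoms_parr, mem_sum_atoms]; exact ⟨t, ht, ih t ht h⟩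

end Tree

namespace Net

theorem mem_ST {p : Net} {x : Tree} :
    x ∈ p.ST ↔ (∃ c ∈ p.cuts, x ∈ c.1.ST ∨ x ∈ c.2.ST) ∨ ∃ t ∈ p.concl, x ∈ t.ST := by
  rw [ST, Finset.mem_union, mem_foldr_union]
  simp only [Finset.mem_biUnion, Finset.mem_union]

theorem ST_trans {p : Net} {x y : Tree} (hxy : x ∈ y.ST) (hy : y ∈ p.ST) : x ∈ p.ST := by
  rw [mem_ST] at hy ⊢
  rcases hy with ⟨c, hc, h | h⟩ | ⟨t, ht, h⟩
  · exact .inl ⟨c, hc, .inl (Tree.ST_trans hxy _ h)⟩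
  · exact .inl ⟨c, hc, .inr (Tree.ST_trans hxy _ h)⟩
  · exact .inr ⟨t, ht, Tree.ST_trans hxy _ h⟩

theorem fst_mem_ST {p : Net} {t s : Tree} (h : (t, s) ∈ p.cuts) : t ∈ p.ST :=
  mem_ST.2 (.inl ⟨_, h, .inl (mem_ST_self _)⟩)

theorem snd_mem_ST {p : Net} {t s : Tree} (h : (t, s) ∈ p.cuts) : s ∈ p.ST :=
  mem_ST.2 (.inl ⟨_, h, .inr (mem_ST_self _)⟩)

theorem exists_atom {p : Net} (hp : p.IsMLL) (x : Tree) : x ∈ p.ST → ∃ a, a ∈ x.atoms := by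
  induction x using premise_induction with
  | var n b => intro _; exact ⟨_, by rw [Tree.atoms]; exact Multiset.mem_singleton_self _⟩
  | unit n => intro _; exact ⟨_, by rw [Tree.atoms]; exact Multiset.mem_singleton_self _⟩
  | counit n => intro _; exact ⟨_, by rw [Tree.atoms]; exact Multiset.mem_singleton_self _⟩
  | tens ts ih =>
    intro h
    obtain ⟨t, ht⟩ := List.exists_mem_of_ne_nil _ (hp.2.1 ts h)
    obtain ⟨a, ha⟩ := ih t ht (ST_trans (ST_premise_tens ht) h)
    exact ⟨a, by rw [atoms_tens, mem_sum_atoms]; exact ⟨t, ht, ha⟩⟩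
  | parr ts ih =>
    intro h
    obtain ⟨t, ht⟩ := List.exists_mem_of_ne_nil _ (hp.2.2.1 ts h)
    obtain ⟨a, ha⟩ := ih t ht (ST_trans (ST_premise_parr ht) h)
    exact ⟨a, by rw [atoms_parr, mem_sum_atoms]; exact ⟨t, ht, ha⟩⟩

theorem mem_atoms_of_cut {c : Tree × Tree} {x : Tree} (hx : x ∈ c.1.ST ∨ x ∈ c.2.ST)
    {a : Atom} (ha : a ∈ x.atoms) : a ∈ c.1.atoms + c.2.atoms := by
  rw [Multiset.mem_add]
  exact hx.imp (atoms_subset_of_mem_ST ha _) (atoms_subset_of_mem_ST ha _)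

/-- A subtree occurs in at most one cut. -/
theorem cut_unique {p : Net} (hp : p.IsMLL) {c d : Tree × Tree} (hc : c ∈ p.cuts)
    (hd : d ∈ p.cuts) {x : Tree} (hxc : x ∈ c.1.ST ∨ x ∈ c.2.ST)
    (hxd : x ∈ d.1.ST ∨ x ∈ d.2.ST) : c = d := by
  by_contra hne
  obtain ⟨a, ha⟩ := exists_atom hp x (mem_ST.2 (.inl ⟨c, hc, hxc⟩))
  obtain ⟨M, hM⟩ := Multiset.exists_cons_of_mem (show c ∈ p.cuts.val from hc)
  have hd' : d ∈ M := by
    have : d ∈ p.cuts.val := hd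
    rw [hM, Multiset.mem_cons] at this
    exact this.resolve_left (Ne.symm hne)
  obtain ⟨M', rfl⟩ := Multiset.exists_cons_of_mem hd'
  have h := (Multiset.nodup_add.1 hp.1).1
  rw [hM] at h
  simp only [Multiset.map_cons, Multiset.sum_cons] at h
  have hdis := (Multiset.nodup_add.1 h).2.2
  exact Multiset.disjoint_left.1 hdis (mem_atoms_of_cut hxc ha)
    (Multiset.mem_add.2 (.inl (mem_atoms_of_cut hxd ha)))

/-- A subtree occurs on at most one side of a cut. -/
theorem cut_sides {p : Net} (hp : p.IsMLL) {t s x : Tree} (hc : (t, s) ∈ p.cuts)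
    (ht : x ∈ t.ST) (hs : x ∈ s.ST) : False := by
  obtain ⟨a, ha⟩ := exists_atom hp x (mem_ST.2 (.inl ⟨_, hc, .inl ht⟩))
  obtain ⟨M, hM⟩ := Multiset.exists_cons_of_mem (show (t, s) ∈ p.cuts.val from hc)
  have h := (Multiset.nodup_add.1 hp.1).1
  rw [hM] at h
  simp only [Multiset.map_cons, Multiset.sum_cons] at h
  have hdis := (Multiset.nodup_add.1 (Multiset.nodup_add.1 h).1).2.2
  exact Multiset.disjoint_left.1 hdis (atoms_subset_of_mem_ST ha _ ht)
    (atoms_subset_of_mem_ST ha _ hs)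

/-- A subtree does not occur both in a cut and in a conclusion. -/
theorem cut_concl {p : Net} (hp : p.IsMLL) {c : Tree × Tree} (hc : c ∈ p.cuts) {t x : Tree}
    (ht : t ∈ p.concl) (hxc : x ∈ c.1.ST ∨ x ∈ c.2.ST) (hxt : x ∈ t.ST) : False := by
  obtain ⟨a, ha⟩ := exists_atom hp x (mem_ST.2 (.inl ⟨c, hc, hxc⟩))
  obtain ⟨M, hM⟩ := Multiset.exists_cons_of_mem (show c ∈ p.cuts.val from hc)
  have hdis := (Multiset.nodup_add.1 hp.1).2.2
  rw [hM] at hdis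
  simp only [Multiset.map_cons, Multiset.sum_cons] at hdis
  exact Multiset.disjoint_left.1 hdis (Multiset.mem_add.2 (.inl (mem_atoms_of_cut hxc ha)))
    (mem_sum_atoms.2 ⟨t, ht, atoms_subset_of_mem_ST ha _ hxt⟩)

/-! ### Switching paths -/

/-- The canonical ordered pair of endpoints of an edge. -/
def ends (p : Net) (J : Tree → Tree) : Edge → Tree × Tree
  | .ax n => (var n true, var n false)
  | .tensE T t => (T, t)
  | .parrE P => (P, J P)
  | .jumpE m => (counit m, p.jump m)
  | .cutE t s => (t, s)

variable {p : Net} {J : Tree → Tree}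

theorem Adj.ends_eq {e : Edge} {t u : Tree} (h : p.Adj J e t u) :
    p.ends J e = (t, u) ∨ p.ends J e = (u, t) := by
  induction h with
  | symm _ ih => exact ih.symm
  | _ => exact .inl rfl

theorem Adj.mem_ST (hp : p.IsMLL) (hJ : p.IsSwitching J) {e : Edge} {t u : Tree}
    (h : p.Adj J e t u) : t ∈ p.ST ∧ u ∈ p.ST := by
  induction h with
  | ax n h h' => exact ⟨h, h'⟩
  | tens h ht => exact ⟨h, ST_trans (ST_premise_tens ht) h⟩
  | parr h => exact ⟨h, ST_trans (ST_premise_parr (hJ _ h)) h⟩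
  | jump h => exact ⟨h, hp.2.2.2.2 _ h⟩
  | cut h => exact ⟨fst_mem_ST h, snd_mem_ST h⟩
  | symm _ ih => exact ih.symm

theorem IsTrail.mem_ST (hp : p.IsMLL) (hJ : p.IsSwitching J) {t : Tree} {S : List (Edge × Tree)}
    (h : p.IsTrail J t S) : t ∈ p.ST ∧ ∀ x ∈ S, x.2 ∈ p.ST := by
  induction h with
  | nil t ht => simpa using ht
  | cons ha _ _ ih =>
    refine ⟨(ha.mem_ST hp hJ).1, fun x hx => ?_⟩
    rcases List.mem_cons.1 hx with rfl | hx
    · exact ih.1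
    · exact ih.2 x hx

/-- The endpoints of the edges of a path are visited by the path. -/
theorem IsTrail.adj_mem {t : Tree} {S : List (Edge × Tree)} (h : p.IsTrail J t S) {e : Edge}
    (he : e ∈ S.map Prod.fst) {a b : Tree} (hab : p.Adj J e a b) : a ∈ t :: S.map Prod.snd := by
  induction h with
  | nil t ht => simp at he
  | cons ha _ _ ih =>
    simp only [List.map_cons, List.mem_cons] at he ih ⊢
    rcases he with rfl | he
    · rcases ha.ends_eq with h1 | h1 <;> rcases hab.ends_eq with h2 | h2 <;>
        rw [h1, Prod.mk.injEq] at h2 <;> simp [h2]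
    · exact .inr (ih he)

/-- An edge of a path incident to its starting point is the first edge of the path. -/
theorem IsTrail.head_of_adj (hpa : p.IsAcyclic) (hJ : p.IsSwitching J) {t : Tree}
    {S : List (Edge × Tree)} (h : p.IsTrail J t S) {e : Edge} {v : Tree}
    (htv : p.Adj J e t v) (he : e ∈ S.map Prod.fst) :
    ∃ S', S = (e, v) :: S' ∧ p.IsTrail J v S' := by
  have hn := hpa J hJ t S h
  cases h with
  | nil => simp at he
  | @cons _ e0 v0 S0 ha ht hd =>
    simp only [List.map_cons, List.mem_cons] at he
    rcases he with rfl | he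
    · have : v = v0 := by
        rcases ha.ends_eq with h1 | h1 <;> rcases htv.ends_eq with h2 | h2 <;>
          rw [h1, Prod.mk.injEq] at h2 <;> grind
      subst this
      exact ⟨S0, rfl, ht⟩
    · exact absurd (ht.adj_mem he htv) (by simpa using (List.nodup_cons.1 hn).1)

theorem IsTrail.append {t v : Tree} {e : Edge} {S₁ S₂ : List (Edge × Tree)} (hp : p.IsMLL)
    (hJ : p.IsSwitching J) (h : p.IsTrail J t (S₁ ++ (e, v) :: S₂)) :
    p.IsTrail J t S₁ ∧ p.IsTrail J v S₂ ∧ (∀ x ∈ S₁, x.1 ≠ e) ∧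
      ∃ w ∈ t :: S₁.map Prod.snd, p.Adj J e w v := by
  induction S₁ generalizing t with
  | nil =>
    cases h with
    | cons ha ht hd =>
      exact ⟨.nil t (ha.mem_ST hp hJ).1, ht, by simp, t, by simp, ha⟩
  | cons y S₁ ih =>
    cases h with
    | cons ha ht hd =>
      obtain ⟨h1, h2, h3, w, hw, hwv⟩ := ih ht
      refine ⟨.cons ha h1 fun x hx => hd x (by simp [hx]), h2, ?_, w,
        List.mem_cons_of_mem _ (by simpa using hw), hwv⟩
      intro x hx
      rcases List.mem_cons.1 hx with rfl | hx
      · exact fun h' => hd (e, v) (by simp) h'.symm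
      · exact h3 x hx

theorem Adj.update {e : Edge} {t u P s : Tree} (h : p.Adj J e t u) (he : e ≠ Edge.parrE P) :
    p.Adj (Function.update J P s) e t u := by
  induction h with
  | ax n h h' => exact .ax n h h'
  | tens h h' => exact .tens h h'
  | @parr ts h =>
    have : Tree.parr ts ≠ P := fun h' => he (by rw [h'])
    have h2 := Adj.parr (I := Function.update J P s) h
    rwa [Function.update_of_ne this] at h2
  | jump h => exact .jump h
  | cut h => exact .cut h
  | symm _ ih => exact .symm (ih he)

theorem IsTrail.update {t P s : Tree} {S : List (Edge × Tree)} (h : p.IsTrail J t S)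
    (hS : Edge.parrE P ∉ S.map Prod.fst) : p.IsTrail (Function.update J P s) t S := by
  induction h with
  | nil t ht => exact .nil t ht
  | cons ha _ hd ih =>
    simp only [List.map_cons, List.mem_cons, not_or] at hS
    exact .cons (ha.update (Ne.symm hS.1)) (ih hS.2) hd

theorem IsSwitching.update {ss : List Tree} {s : Tree} (hJ : p.IsSwitching J) (hs : s ∈ ss) :
    p.IsSwitching (Function.update J (Tree.parr ss) s) := by
  intro ts hts
  by_cases h : Tree.parr ts = Tree.parr ss
  · rw [h, Function.update_self]; cases h; exact hs
  · rw [Function.update_of_ne h]; exact hJ ts hts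

theorem IsTrail.length_le (hp : p.IsMLL) (hpa : p.IsAcyclic) (hJ : p.IsSwitching J) {t : Tree}
    {S : List (Edge × Tree)} (h : p.IsTrail J t S) : S.length ≤ p.ln := by
  refine le_csSup ⟨p.ST.card, ?_⟩ ⟨J, t, S, hJ, h, rfl⟩
  rintro n ⟨J, t, S, hJ, h, rfl⟩
  have hsub : (t :: S.map Prod.snd).toFinset ⊆ p.ST := by
    intro x hx
    have := h.mem_ST hp hJ
    simp only [List.mem_toFinset, List.mem_cons, List.mem_map] at hx
    rcases hx with rfl | ⟨y, hy, rfl⟩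
    · exact this.1
    · exact this.2 y hy
  have := Finset.card_le_card hsub
  rw [List.toFinset_card_of_nodup (hpa J hJ t S h)] at this
  simp at this
  omega

/-- If a path starting from a premise of a ⅋-tree crosses the edge of this tree, then it does so
from another premise towards the tree: otherwise, it would close a cycle. -/
theorem IsTrail.split_parr (hp : p.IsMLL) (hpa : p.IsAcyclic) (hJ : p.IsSwitching J) {s : Tree}
    {ss : List Tree} (hss : Tree.parr ss ∈ p.ST) (hs : s ∈ ss) {S : List (Edge × Tree)}
    (h : p.IsTrail J s S) (he : Edge.parrE (Tree.parr ss) ∈ S.map Prod.fst) :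
    ∃ S₁ S₂, S = S₁ ++ (Edge.parrE (Tree.parr ss), Tree.parr ss) :: S₂ ∧
      p.IsTrail J (Tree.parr ss) S₂ := by
  obtain ⟨⟨_, v⟩, hx, rfl⟩ := List.mem_map.1 he
  obtain ⟨S₁, S₂, rfl⟩ := List.append_of_mem hx
  obtain ⟨h1, h2, h3, w, hw, hwv⟩ := h.append hp hJ
  have key : Tree.parr ss ∉ s :: S₁.map Prod.snd := by
    have hadj := Adj.parr (I := Function.update J (Tree.parr ss) s) hss
    rw [Function.update_self] at hadj
    have := hpa _ (hJ.update hs) _ _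
      (.cons hadj (h1.update (s := s) fun hm => by
        obtain ⟨x, hx, hxe⟩ := List.mem_map.1 hm
        exact h3 x hx hxe) h3)
    exact (List.nodup_cons.1 this).1
  rcases hwv.ends_eq with h4 | h4
  · obtain ⟨rfl, -⟩ := Prod.mk.inj h4
    exact absurd hw key
  · obtain ⟨rfl, -⟩ := Prod.mk.inj h4
    exact ⟨S₁, S₂, rfl, h2⟩

end Net

/-! ### Weight of a path -/

/-- The digit of an edge leaving a given vertex. Whenever the translation of a path of `q` to a
path of `p` backtracks to a previously visited tree, it leaves that tree along an edge with a
greater digit. -/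
def digit : Edge × Tree → ℕ
  | (.tensE _ _, _) => 2
  | (.cutE _ _, .parr _) => 2
  | (.jumpE _, _) => 3
  | _ => 1

/-- The weight of a path: the base 4 fractional number given by its digits (in reverse order),
scaled by `4 ^ N`. -/
def weight (N : ℕ) : List (Edge × Tree) → ℕ
  | [] => 0
  | x :: S => weight N S + digit x * 4 ^ (N - (S.length + 1))

theorem one_le_digit (x : Edge × Tree) : 1 ≤ digit x := by
  unfold digit; split <;> omega

theorem digit_le (x : Edge × Tree) : digit x ≤ 3 := by
  unfold digit; split <;> omega

theorem weight_lt_cons (N : ℕ) (x : Edge × Tree) (S : List (Edge × Tree)) :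
    weight N S + 1 ≤ weight N (x :: S) := by
  have := Nat.mul_le_mul (one_le_digit x) (Nat.one_le_pow (N - (S.length + 1)) 4 (by norm_num))
  simp only [weight]; omega

theorem weight_append_le {N : ℕ} (S₁ S₂ : List (Edge × Tree)) (h : (S₁ ++ S₂).length ≤ N) :
    weight N (S₁ ++ S₂) + 4 ^ (N - (S₁ ++ S₂).length) ≤ weight N S₂ + 4 ^ (N - S₂.length) := by
  induction S₁ with
  | nil => simp
  | cons z S₁ ih =>
    simp only [List.cons_append, List.length_cons] at h ih ⊢
    have ih := ih (by omega)
    simp only [weight]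
    obtain ⟨k, hk⟩ : ∃ k, N - (S₁ ++ S₂).length = k + 1 := ⟨N - (S₁ ++ S₂).length - 1, by omega⟩
    rw [show N - ((S₁ ++ S₂).length + 1) = k by omega]
    rw [hk, pow_succ] at ih
    have := Nat.mul_le_mul_right (4 ^ k) (digit_le z)
    omega

theorem weight_lt_of_digit_lt {N : ℕ} {S₁ S₂ : List (Edge × Tree)} {x y : Edge × Tree}
    (h : (S₁ ++ x :: S₂).length ≤ N) (hxy : digit x < digit y) :
    weight N (S₁ ++ x :: S₂) + 1 ≤ weight N (y :: S₂) := by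
  have h1 := weight_append_le S₁ (x :: S₂) h
  have h2 := Nat.one_le_pow (N - (S₁ ++ x :: S₂).length) 4 (by norm_num)
  have h3 := Nat.mul_le_mul_right (4 ^ (N - (S₂.length + 1))) (Nat.succ_le_of_lt hxy)
  simp only [weight, List.length_cons, Nat.succ_mul] at h1 h3 ⊢
  omega

theorem weight_lt_pow {N : ℕ} {S : List (Edge × Tree)} (h : S.length ≤ N) :
    weight N S + 1 ≤ 4 ^ N := by
  have h1 := weight_append_le S [] (by simpa using h)
  have h2 := Nat.one_le_pow (N - S.length) 4 (by norm_num)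
  simp [weight] at h1
  omega

theorem pow_le_phi (n : ℕ) : 4 ^ n ≤ phi n + 1 := by
  induction n with
  | zero => simp [phi]
  | succ n ih =>
    rcases n with _ | _ | n
    · simp [phi]
    · simp [phi]
    · rw [pow_succ, phi]
      generalize phi (n + 1 + 1) = a at *
      nlinarith

/-! ### Translating paths of `q` to paths of `p` -/

/-- The edges of `p` erased by the elimination of the cuts of `F`. -/
def IsErased (F : Finset (List Tree × List Tree)) (e : Edge) : Prop :=
  ∃ c ∈ F, (∃ t, e = .tensE (tens c.1) t) ∨ e = .parrE (parr c.2) ∨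
    e = .cutE (tens c.1) (parr c.2) ∨ e = .cutE (parr c.2) (tens c.1)

section MultStep

variable {p q : Net} {F : Finset (List Tree × List Tree)} {I J : Tree → Tree}

theorem ParStepF.mult_cuts (h : ParStepF p q F [] []) :
    q.cuts = (p.cuts \ melim F) ∪ mres F := by
  rw [h.hcuts]
  simp [substList, aelim, eelim]

theorem ParStepF.mult_concl (h : ParStepF p q F [] []) : q.concl = p.concl := by
  rw [h.hconcl]
  exact List.map_id _

theorem ParStepF.mult_jump (h : ParStepF p q F [] []) {m : ℕ} (hm : counit m ∈ q.ST) :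
    (∃ c ∈ F, p.jump m = tens c.1 ∧ q.jump m = c.1.headI) ∨
    (∃ c ∈ F, p.jump m = parr c.2 ∧ q.jump m = c.2.headI) ∨ q.jump m = p.jump m := by
  have := h.hjump m hm
  simp only [substList, List.foldl_nil, List.length_nil, Nat.not_lt_zero, false_and,
    exists_false, false_or] at this
  exact this.imp_right (Or.imp_right fun h => h.2.2.2)

theorem mem_melim {x : Tree × Tree} :
    x ∈ melim F ↔ ∃ c ∈ F, x = (tens c.1, parr c.2) ∨ x = (parr c.2, tens c.1) := by
  simp [melim]

theorem mem_mres {x : Tree × Tree} : x ∈ mres F ↔ ∃ c ∈ F, x ∈ c.1.zip c.2 := by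
  simp [mres]

theorem ParStepF.exists_cut_edge (h : ParStepF p q F [] []) {c} (hc : c ∈ F) :
    ∃ t s, IsErased F (.cutE t s) ∧
      ∀ J, p.Adj J (.cutE t s) (tens c.1) (parr c.2) := by
  rcases (h.hF c hc).2.2 with h | h
  · exact ⟨_, _, ⟨c, hc, by simp⟩, fun J => .cut h⟩
  · exact ⟨_, _, ⟨c, hc, by simp⟩, fun J => .symm (.cut h)⟩

theorem ParStepF.tens_mem (h : ParStepF p q F [] []) {c} (hc : c ∈ F) : tens c.1 ∈ p.ST := by
  rcases (h.hF c hc).2.2 with h | h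
  exacts [Net.fst_mem_ST h, Net.snd_mem_ST h]

theorem ParStepF.parr_mem (h : ParStepF p q F [] []) {c} (hc : c ∈ F) : parr c.2 ∈ p.ST := by
  rcases (h.hF c hc).2.2 with h | h
  exacts [Net.snd_mem_ST h, Net.fst_mem_ST h]

theorem ParStepF.ST_subset (h : ParStepF p q F [] []) : q.ST ⊆ p.ST := by
  intro x hx
  rw [Net.mem_ST, h.mult_cuts, h.mult_concl] at hx
  rcases hx with ⟨d, hd, hx⟩ | ⟨t, ht, hx⟩
  · rcases Finset.mem_union.1 hd with hd | hd
    · exact Net.mem_ST.2 (.inl ⟨d, (Finset.mem_sdiff.1 hd).1, hx⟩)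
    · obtain ⟨c, hc, hd⟩ := mem_mres.1 hd
      obtain ⟨h1, h2⟩ := List.of_mem_zip (a := d.1) (b := d.2) hd
      rcases hx with hx | hx
      · exact Net.ST_trans (Tree.ST_trans hx _ (ST_premise_tens h1)) (h.tens_mem hc)
      · exact Net.ST_trans (Tree.ST_trans hx _ (ST_premise_parr h2)) (h.parr_mem hc)
  · exact Net.mem_ST.2 (.inr ⟨t, ht, hx⟩)

/-- The trees of the eliminated cuts are not subtrees of the reduct. -/
theorem ParStepF.notMem_ST (h : ParStepF p q F [] []) (hp : p.IsMLL) {c} (hc : c ∈ F) {x : Tree}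
    (hx : x = tens c.1 ∨ x = parr c.2) : x ∉ q.ST := by
  have hcut : ∀ c ∈ F, ∃ k ∈ p.cuts, (k = (tens c.1, parr c.2) ∨ k = (parr c.2, tens c.1)) := by
    intro c hc
    rcases (h.hF c hc).2.2 with h | h
    exacts [⟨_, h, .inl rfl⟩, ⟨_, h, .inr rfl⟩]
  obtain ⟨k, hk, hkc⟩ := hcut c hc
  have hxk : x ∈ k.1.ST ∨ x ∈ k.2.ST := by
    rcases hkc with rfl | rfl <;> rcases hx with rfl | rfl <;> simp [mem_ST_self]
  intro hxq
  rw [Net.mem_ST, h.mult_cuts, h.mult_concl] at hxq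
  rcases hxq with ⟨d, hd, hxd⟩ | ⟨t, ht, hxt⟩
  · rcases Finset.mem_union.1 hd with hd | hd
    · obtain ⟨hd, hd'⟩ := Finset.mem_sdiff.1 hd
      have := Net.cut_unique hp hk hd hxk hxd
      subst this
      exact hd' (mem_melim.2 ⟨c, hc, hkc⟩)
    · obtain ⟨c', hc', hd⟩ := mem_mres.1 hd
      obtain ⟨h1, h2⟩ := List.of_mem_zip (a := d.1) (b := d.2) hd
      obtain ⟨k', hk', hkc'⟩ := hcut c' hc'
      have hxd' : x ∈ (tens c'.1).ST ∨ x ∈ (parr c'.2).ST :=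
        hxd.imp (Tree.ST_trans · _ (ST_premise_tens h1)) (Tree.ST_trans · _ (ST_premise_parr h2))
      have hkk : k = k' := Net.cut_unique hp hk hk' hxk (by
        rcases hkc' with rfl | rfl
        exacts [hxd', hxd'.symm])
      have hcc : c = c' := by
        obtain ⟨c1, c2⟩ := c
        obtain ⟨c1', c2'⟩ := c'
        rcases hkc with rfl | rfl <;> rcases hkc' with rfl | rfl <;> simp_all
      subst hkk hcc
      have hboth : ¬ (x ∈ (tens c.1).ST ∧ x ∈ (parr c.2).ST) := by
        rintro ⟨ha, hb⟩
        rcases hkc with rfl | rfl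
        · exact Net.cut_sides hp hk ha hb
        · exact Net.cut_sides hp hk hb ha
      rcases hx with rfl | rfl <;> rcases hxd with hxd | hxd
      · exact tens_notMem_ST_premise h1 hxd
      · exact hboth ⟨mem_ST_self _, Tree.ST_trans hxd _ (ST_premise_parr h2)⟩
      · exact hboth ⟨Tree.ST_trans hxd _ (ST_premise_tens h1), mem_ST_self _⟩
      · exact parr_notMem_ST_premise h2 hxd
  · exact Net.cut_concl hp hk ht hxk hxt

theorem ParStepF.residual_mem (h : ParStepF p q F [] []) {c} (hc : c ∈ F) {t s : Tree}
    (hts : (t, s) ∈ c.1.zip c.2) : (t, s) ∈ q.cuts := by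
  rw [h.mult_cuts]
  exact Finset.mem_union_right _ (mem_mres.2 ⟨c, hc, hts⟩)

/-- Classification of the edges of the reduct: preserved edges, residuals of eliminated cuts, and
redirected jumps, each of the latter two in one of two directions. -/
theorem ParStepF.adj_cases (h : ParStepF p q F [] []) (hp : p.IsMLL) {e : Edge} {t u : Tree}
    (hadj : q.Adj I e t u) :
    ((∀ J, (∀ ts, parr ts ∈ q.ST → J (parr ts) = I (parr ts)) → p.Adj J e t u) ∧
      ¬ IsErased F e) ∨
    ∃ c ∈ F,
      ((t, u) ∈ c.1.zip c.2 ∧ e = .cutE t u) ∨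
      ((u, t) ∈ c.1.zip c.2 ∧ e = .cutE u t) ∨
      (∃ m, e = .jumpE m ∧ counit m ∈ p.ST ∧
        ((p.jump m = tens c.1 ∧
            ((t = counit m ∧ u = c.1.headI) ∨ (u = counit m ∧ t = c.1.headI))) ∨
         (p.jump m = parr c.2 ∧
            ((t = counit m ∧ u = c.2.headI) ∨ (u = counit m ∧ t = c.2.headI))))) := by
  induction hadj with
  | ax n h1 h2 =>
    refine .inl ⟨fun J _ => .ax n (h.ST_subset h1) (h.ST_subset h2), ?_⟩
    rintro ⟨c, hc, h⟩; simp at h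
  | tens h1 h2 =>
    refine .inl ⟨fun J _ => .tens (h.ST_subset h1) h2, ?_⟩
    rintro ⟨c, hc, ⟨x, hx⟩ | hx | hx | hx⟩ <;> cases hx
    exact h.notMem_ST hp hc (.inl rfl) h1
  | parr h1 =>
    refine .inl ⟨fun J hJ => ?_, ?_⟩
    · rw [← hJ _ h1]; exact .parr (h.ST_subset h1)
    rintro ⟨c, hc, ⟨x, hx⟩ | hx | hx | hx⟩ <;> cases hx
    exact h.notMem_ST hp hc (.inr rfl) h1
  | @jump m h1 =>
    have h1' := h.ST_subset h1
    rcases h.mult_jump h1 with ⟨c, hc, h2, h3⟩ | ⟨c, hc, h2, h3⟩ | h2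
    · exact .inr ⟨c, hc, .inr (.inr ⟨m, rfl, h1', .inl ⟨h2, .inl ⟨rfl, h3⟩⟩⟩)⟩
    · exact .inr ⟨c, hc, .inr (.inr ⟨m, rfl, h1', .inr ⟨h2, .inl ⟨rfl, h3⟩⟩⟩)⟩
    · refine .inl ⟨fun J _ => h2 ▸ .jump h1', ?_⟩
      rintro ⟨c, hc, h⟩; simp at h
  | @cut t s h1 =>
    rw [h.mult_cuts] at h1
    rcases Finset.mem_union.1 h1 with h1 | h1
    · obtain ⟨h1, h2⟩ := Finset.mem_sdiff.1 h1
      refine .inl ⟨fun J _ => .cut h1, ?_⟩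
      rintro ⟨c, hc, ⟨x, hx⟩ | hx | hx | hx⟩ <;> cases hx
      · exact h2 (mem_melim.2 ⟨c, hc, .inl rfl⟩)
      · exact h2 (mem_melim.2 ⟨c, hc, .inr rfl⟩)
    · obtain ⟨c, hc, h1⟩ := mem_mres.1 h1
      exact .inr ⟨c, hc, .inl ⟨h1, rfl⟩⟩
  | symm _ ih =>
    rcases ih with ⟨h1, h2⟩ | ⟨c, hc, h1 | h1 | ⟨m, rfl, hm, ⟨h1, h2⟩ | ⟨h1, h2⟩⟩⟩
    · exact .inl ⟨fun J hJ => .symm (h1 J hJ), h2⟩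
    · exact .inr ⟨c, hc, .inr (.inl h1)⟩
    · exact .inr ⟨c, hc, .inl h1⟩
    · exact .inr ⟨c, hc, .inr (.inr ⟨m, rfl, hm, .inl ⟨h1, h2.symm⟩⟩)⟩
    · exact .inr ⟨c, hc, .inr (.inr ⟨m, rfl, hm, .inr ⟨h1, h2.symm⟩⟩)⟩

/-- A path `S` of `p` from `t` to a fixed endpoint, all of whose edges and vertices come from a
path `l` of `q`, up to the erased edges and trees. -/
structure IsLift (p q : Net) (F : Finset (List Tree × List Tree)) (I : Tree → Tree) (t : Tree)
    (l : List (Edge × Tree)) (J : Tree → Tree) (S : List (Edge × Tree)) : Prop where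
  switching : p.IsSwitching J
  agree : ∀ ts, parr ts ∈ q.ST → J (parr ts) = I (parr ts)
  trail : p.IsTrail J t S
  visited : ∀ x ∈ S, x.2 ∈ q.ST → x.2 ∈ l.map Prod.snd
  edges : ∀ x ∈ S, x.1 ∈ l.map Prod.fst ∨ IsErased F x.1

/-- The path `S` of `p` is obtained from the path `l` of `q` by translating edges and erasing
the loops. -/
structure Simulates (p q : Net) (F : Finset (List Tree × List Tree)) (I : Tree → Tree) (N : ℕ)
    (t : Tree) (l : List (Edge × Tree)) (J : Tree → Tree) (S : List (Edge × Tree)) : Prop extends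
    IsLift p q F I t l J S where
  first : ∀ c ∈ F, ∀ t' S', S = (.tensE (tens c.1) t', tens c.1) :: S' →
    (∃ s x l', l = (.cutE t' s, x) :: l' ∧ (t', s) ∈ q.cuts) ∨
    (∃ m v S'', S' = (.jumpE m, v) :: S'' ∧ l.length ≤ weight N S')
  count : l.length ≤ weight N S

namespace IsLift

variable {t u : Tree} {l S : List (Edge × Tree)}

theorem mono (hl : IsLift p q F I t l J S) (y : Edge × Tree) : IsLift p q F I t (y :: l) J S :=
  ⟨hl.switching, hl.agree, hl.trail,
    fun x hx hq => List.mem_cons_of_mem _ (hl.visited x hx hq),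
    fun x hx => (hl.edges x hx).imp_left (List.mem_cons_of_mem _)⟩

theorem push (hl : IsLift p q F I t l J S) {e : Edge} (ha : p.Adj J e u t)
    (he : e ∉ S.map Prod.fst) (hel : e ∈ l.map Prod.fst ∨ IsErased F e)
    (ht : t ∈ q.ST → t ∈ l.map Prod.snd) : IsLift p q F I u l J ((e, t) :: S) where
  switching := hl.switching
  agree := hl.agree
  trail := .cons ha hl.trail fun x hx h => he (h ▸ List.mem_map_of_mem hx)
  visited := by
    intro x hx
    rcases List.mem_cons.1 hx with rfl | hx
    exacts [ht, hl.visited x hx]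
  edges := by
    intro x hx
    rcases List.mem_cons.1 hx with rfl | hx
    exacts [hel, hl.edges x hx]

theorem suffix (hl : IsLift p q F I t l J S) {A B : List (Edge × Tree)} (hS : S = A ++ B)
    (hB : p.IsTrail J u B) : IsLift p q F I u l J B :=
  ⟨hl.switching, hl.agree, hB, fun x hx => hl.visited x (by simp [hS, hx]),
    fun x hx => hl.edges x (by simp [hS, hx])⟩

theorem update (hl : IsLift p q F I t l J S) {ss : List Tree} {s : Tree} (hs : s ∈ ss)
    (hss : parr ss ∉ q.ST) (he : .parrE (parr ss) ∉ S.map Prod.fst) :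
    IsLift p q F I t l (Function.update J (parr ss) s) S where
  switching := hl.switching.update hs
  agree := fun ts hts => by
    have hne : parr ts ≠ parr ss := fun h => hss (h ▸ hts)
    rw [Function.update_of_ne hne, hl.agree ts hts]
  trail := hl.trail.update he
  visited := hl.visited
  edges := hl.edges

theorem edge_notMem (hl : IsLift p q F I t l J S) {e : Edge} (h1 : e ∉ l.map Prod.fst)
    (h2 : ¬ IsErased F e) : e ∉ S.map Prod.fst := by
  intro h
  obtain ⟨x, hx, rfl⟩ := List.mem_map.1 h
  exact (hl.edges x hx).elim h1 h2

end IsLift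

theorem not_isErased_jumpE (m : ℕ) : ¬ IsErased F (.jumpE m) := by
  rintro ⟨c, hc, h⟩; simp at h

section Moves

variable {N : ℕ} {t u : Tree} {l S : List (Edge × Tree)} {c : List Tree × List Tree} {m : ℕ}

/-- Moving from the ⅋-tree of an eliminated cut to one of its premises. -/
theorem IsLift.push_parr_premise (h : ParStepF p q F [] []) (hp : p.IsMLL) (hc : c ∈ F)
    (hu : u ∈ c.2) (hl : IsLift p q F I (parr c.2) l J S)
    (he : .parrE (parr c.2) ∉ S.map Prod.fst) :
    ∃ J', IsLift p q F I u l J' ((.parrE (parr c.2), parr c.2) :: S) := by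
  have hq := h.notMem_ST hp hc (.inr rfl)
  refine ⟨_, (hl.update hu hq he).push ?_ he (.inr ⟨c, hc, by simp⟩) (absurd · hq)⟩
  have := Net.Adj.parr (I := Function.update J (parr c.2) u) (h.parr_mem hc)
  rw [Function.update_self] at this
  exact this.symm

/-- Moving from a premise of the ⅋-tree of an eliminated cut to this tree, possibly by
backtracking. -/
theorem IsLift.reach_parr (h : ParStepF p q F [] []) (hp : p.IsMLL) (hpa : p.IsAcyclic)
    (hc : c ∈ F) (ht : t ∈ c.2) (hl : IsLift p q F I t l J S)
    (htl : t ∈ l.map Prod.snd) :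
    ∃ J' S', IsLift p q F I (parr c.2) l J' S' ∧
      (S' = (.parrE (parr c.2), t) :: S ∨
        ∃ S₁, S = S₁ ++ (.parrE (parr c.2), parr c.2) :: S') := by
  by_cases he : .parrE (parr c.2) ∈ S.map Prod.fst
  · obtain ⟨S₁, S₂, hS, h2⟩ := hl.trail.split_parr hp hpa hl.switching (h.parr_mem hc) ht he
    exact ⟨J, S₂, hl.suffix (A := S₁ ++ [(.parrE (parr c.2), parr c.2)]) (by rw [hS]; simp) h2,
      .inr ⟨S₁, hS⟩⟩
  · have hq := h.notMem_ST hp hc (.inr rfl)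
    refine ⟨_, _, (hl.update ht hq he).push ?_ he (.inr ⟨c, hc, by simp⟩) (fun _ => htl), .inl rfl⟩
    have := Net.Adj.parr (I := Function.update J (parr c.2) t) (h.parr_mem hc)
    rwa [Function.update_self] at this

/-- Moving from a premise of the ⊗-tree of an eliminated cut to this tree, possibly by
backtracking. -/
theorem IsLift.reach_tens (h : ParStepF p q F [] []) (hpa : p.IsAcyclic)
    (hc : c ∈ F) (ht : t ∈ c.1) (hl : IsLift p q F I t l J S) (htl : t ∈ l.map Prod.snd) :
    ∃ S', IsLift p q F I (tens c.1) l J S' ∧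
      (S' = (.tensE (tens c.1) t, t) :: S ∨ S = (.tensE (tens c.1) t, tens c.1) :: S') := by
  have ha : p.Adj J (.tensE (tens c.1) t) (tens c.1) t := .tens (h.tens_mem hc) ht
  by_cases he : .tensE (tens c.1) t ∈ S.map Prod.fst
  · obtain ⟨S', hS, h2⟩ := hl.trail.head_of_adj hpa hl.switching ha.symm he
    exact ⟨S', hl.suffix (A := [_]) (by rw [hS]; rfl) h2, .inr hS⟩
  · exact ⟨_, hl.push ha he (.inr ⟨c, hc, by simp⟩) (fun _ => htl), .inl rfl⟩

/-- An edge incident to the starting point of a path, and distinct from its first edge, does not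
occur in it. -/
theorem IsLift.notMem_of_head (hpa : p.IsAcyclic) {x : Edge × Tree}
    (hl : IsLift p q F I t l J (x :: S)) {e : Edge} (ha : p.Adj J e t u) (hx : x.1 ≠ e) :
    e ∉ (x :: S).map Prod.fst := by
  intro he
  obtain ⟨S', hS, -⟩ := hl.trail.head_of_adj hpa hl.switching ha he
  rw [List.cons.injEq] at hS
  exact hx (by rw [hS.1])

theorem Simulates.preserved (hs : Simulates p q F I N t l J S) {e : Edge} (ha : p.Adj J e u t)
    (he : e ∉ l.map Prod.fst) (heF : ¬ IsErased F e) :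
    ∃ J' S', Simulates p q F I N u ((e, t) :: l) J' S' := by
  refine ⟨J, (e, t) :: S, (hs.mono (e, t)).push ha (hs.edge_notMem he heF) (.inl (by simp))
    (fun _ => by simp), ?_, ?_⟩
  · intro c hc t' S' hS
    obtain ⟨⟨rfl, rfl⟩, rfl⟩ := by simpa using hS
    exact absurd ⟨c, hc, by simp⟩ heF
  · have := weight_lt_cons N (e, t) S
    have := hs.count
    simp only [List.length_cons]; omega

theorem Simulates.residual_parr (h : ParStepF p q F [] []) (hp : p.IsMLL) (hq : q.IsMLL)
    (hpa : p.IsAcyclic) (hs : Simulates p q F I N t l J S) (hc : c ∈ F)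
    (hz : (t, u) ∈ c.1.zip c.2) (he : .cutE t u ∉ l.map Prod.fst) :
    ∃ J' S', Simulates p q F I N u ((.cutE t u, t) :: l) J' S' := by
  obtain ⟨ht, hu⟩ := List.of_mem_zip hz
  obtain ⟨a, b, herased, hadj⟩ := h.exists_cut_edge hc
  have hcount := hs.count
  have key : ∃ S', IsLift p q F I (tens c.1) ((.cutE t u, t) :: l) J S' ∧
      l.length ≤ weight N S' ∧ .cutE a b ∉ S'.map Prod.fst := by
    obtain ⟨S', hl, rfl | rfl⟩ := (hs.mono (.cutE t u, t)).reach_tens h hpa hc ht (by simp)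
    · refine ⟨_, hl, ?_, hl.notMem_of_head hpa (hadj J) (by simp)⟩
      have := weight_lt_cons N (.tensE (tens c.1) t, t) S
      omega
    · rcases hs.first c hc _ _ rfl with ⟨s, x, l', rfl, hcut⟩ | ⟨m, v, S'', rfl, hcnt⟩
      · have := Net.cut_unique hq hcut (h.residual_mem hc hz) (x := t)
          (.inl (mem_ST_self _)) (.inl (mem_ST_self _))
        simp only [Prod.mk.injEq, true_and] at this
        simp [this] at he
      · exact ⟨_, hl, hcnt, hl.notMem_of_head hpa (hadj J) (by simp)⟩
  obtain ⟨S', hl, hcnt, hcut⟩ := key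
  have hl' := hl.push (hadj J).symm hcut (.inr herased)
    (absurd · (h.notMem_ST hp hc (.inl rfl)))
  obtain ⟨J', hl''⟩ := hl'.push_parr_premise h hp hc hu
    (hl'.notMem_of_head hpa (.parr (h.parr_mem hc)) (by simp))
  refine ⟨J', _, hl'', by simp, ?_⟩
  have h1 := weight_lt_cons N (.cutE a b, tens c.1) S'
  have h2 := weight_lt_cons N (.parrE (parr c.2), parr c.2) ((.cutE a b, tens c.1) :: S')
  simp only [List.length_cons]; omega

theorem Simulates.residual_tens (h : ParStepF p q F [] []) (hp : p.IsMLL)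
    (hpa : p.IsAcyclic) (hN : ∀ J t S, p.IsSwitching J → p.IsTrail J t S → S.length ≤ N)
    (hs : Simulates p q F I N t l J S) (hc : c ∈ F) (hz : (u, t) ∈ c.1.zip c.2)
    (huq : u ∈ q.ST) (hul : u ∉ t :: l.map Prod.snd) :
    ∃ J' S', Simulates p q F I N u ((.cutE u t, t) :: l) J' S' := by
  obtain ⟨hu, ht⟩ := List.of_mem_zip hz
  obtain ⟨a, b, herased, hadj⟩ := h.exists_cut_edge hc
  have hcount := hs.count
  have hlen := hN _ _ _ hs.switching hs.trail
  have htens : ∀ J, p.Adj J (.tensE (tens c.1) u) (tens c.1) u :=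
    fun J => .tens (h.tens_mem hc) hu
  have fin : ∀ J' S', IsLift p q F I (tens c.1) ((.cutE u t, t) :: l) J' S' →
      .tensE (tens c.1) u ∉ S'.map Prod.fst →
      l.length + 1 ≤ weight N ((.tensE (tens c.1) u, tens c.1) :: S') →
      ∃ J' S', Simulates p q F I N u ((.cutE u t, t) :: l) J' S' := by
    intro J' S' hl hnot hcnt
    refine ⟨J', _, hl.push (htens J').symm hnot (.inr ⟨c, hc, by simp⟩)
      (absurd · (h.notMem_ST hp hc (.inl rfl))), ?_, by simpa using hcnt⟩
    intro c' hc' t' S'' hS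
    simp only [List.cons.injEq, Prod.mk.injEq, Edge.tensE.injEq] at hS
    exact .inl ⟨t, t, l, by rw [hS.1.1.2], hS.1.1.2 ▸ h.residual_mem hc hz⟩
  obtain ⟨J', S', hl, hS⟩ := (hs.mono (.cutE u t, t)).reach_parr h hp hpa hc ht (by simp)
  have digit_cut : digit (.cutE a b, parr c.2) = 2 := by simp [digit]
  have digit_cut' : digit (.cutE a b, tens c.1) = 1 := by simp [digit]
  by_cases hcut : .cutE a b ∈ S'.map Prod.fst
  · obtain ⟨S'', rfl, h2⟩ := hl.trail.head_of_adj hpa hl.switching (hadj J').symm hcut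
    obtain ⟨S₁, rfl⟩ := hS.resolve_left (by simp)
    have hl2 := hl.suffix (A := [_]) rfl h2
    refine fin J' S'' hl2 (fun hmem => ?_) ?_
    · obtain ⟨S3, rfl, -⟩ := h2.head_of_adj hpa hl.switching (htens J') hmem
      exact hul (by simpa using hl2.visited _ (List.mem_cons_self) huq)
    · have := weight_lt_of_digit_lt (N := N) (S₁ := S₁ ++ [(.parrE (parr c.2), parr c.2)])
        (S₂ := S'') (x := (.cutE a b, tens c.1)) (y := (.tensE (tens c.1) u, tens c.1))
        (by simpa using hlen) (by rw [digit_cut']; simp [digit])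
      simp only [List.append_assoc, List.singleton_append] at this
      omega
  · have hl2 := hl.push (hadj J') hcut (.inr herased)
      (absurd · (h.notMem_ST hp hc (.inr rfl)))
    refine fin J' _ hl2 (hl2.notMem_of_head hpa (htens J') (by simp)) ?_
    have h1 := weight_lt_cons N (.tensE (tens c.1) u, tens c.1) ((.cutE a b, parr c.2) :: S')
    rcases hS with rfl | ⟨S₁, rfl⟩
    · have h2 := weight_lt_cons N (.parrE (parr c.2), t) S
      have h3 := weight_lt_cons N (.cutE a b, parr c.2) ((.parrE (parr c.2), t) :: S)
      omega
    · have := weight_lt_of_digit_lt (y := (.cutE a b, parr c.2)) hlen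
        (by rw [digit_cut]; simp [digit])
      omega

theorem Simulates.jump_from_tens (h : ParStepF p q F [] []) (hp : p.IsMLL)
    (hpa : p.IsAcyclic) (hN : ∀ J t S, p.IsSwitching J → p.IsTrail J t S → S.length ≤ N)
    (hs : Simulates p q F I N t l J S) (hc : c ∈ F) (ht : t ∈ c.1) (hm : counit m ∈ p.ST)
    (hj : p.jump m = tens c.1) (he : .jumpE m ∉ l.map Prod.fst) :
    ∃ J' S', Simulates p q F I N (counit m) ((.jumpE m, t) :: l) J' S' := by
  have hlen := hN _ _ _ hs.switching hs.trail
  have hcount := hs.count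
  have hnot := hs.edge_notMem he (not_isErased_jumpE m)
  obtain ⟨S', hl, hS⟩ := (hs.mono (.jumpE m, t)).reach_tens h hpa hc ht (by simp)
  refine ⟨J, (.jumpE m, tens c.1) :: S', hl.push (hj ▸ .jump hm) ?_ (.inl (by simp))
    (absurd · (h.notMem_ST hp hc (.inl rfl))), by simp, ?_⟩
  · rcases hS with rfl | rfl
    · simpa using hnot
    · exact fun h => hnot (List.mem_cons_of_mem _ h)
  · simp only [List.length_cons]
    rcases hS with rfl | rfl
    · have h1 := weight_lt_cons N (.tensE (tens c.1) t, t) S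
      have h2 := weight_lt_cons N (.jumpE m, tens c.1) ((.tensE (tens c.1) t, t) :: S)
      omega
    · have := weight_lt_of_digit_lt (S₁ := []) (y := (.jumpE m, tens c.1)) hlen (by simp [digit])
      simp only [List.nil_append] at this
      omega

theorem Simulates.jump_from_parr (h : ParStepF p q F [] []) (hp : p.IsMLL)
    (hpa : p.IsAcyclic) (hN : ∀ J t S, p.IsSwitching J → p.IsTrail J t S → S.length ≤ N)
    (hs : Simulates p q F I N t l J S) (hc : c ∈ F) (ht : t ∈ c.2) (hm : counit m ∈ p.ST)
    (hj : p.jump m = parr c.2) (he : .jumpE m ∉ l.map Prod.fst) :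
    ∃ J' S', Simulates p q F I N (counit m) ((.jumpE m, t) :: l) J' S' := by
  have hlen := hN _ _ _ hs.switching hs.trail
  have hcount := hs.count
  have hnot := hs.edge_notMem he (not_isErased_jumpE m)
  obtain ⟨J', S', hl, hS⟩ := (hs.mono (.jumpE m, t)).reach_parr h hp hpa hc ht (by simp)
  refine ⟨J', (.jumpE m, parr c.2) :: S', hl.push (hj ▸ .jump hm) ?_ (.inl (by simp))
    (absurd · (h.notMem_ST hp hc (.inr rfl))), by simp, ?_⟩
  · rcases hS with rfl | ⟨S₁, rfl⟩
    · simpa using hnot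
    · exact fun h => hnot (by
        rw [List.map_append]
        exact List.mem_append_right _ (List.mem_cons_of_mem _ h))
  · simp only [List.length_cons]
    rcases hS with rfl | ⟨S₁, rfl⟩
    · have h1 := weight_lt_cons N (.parrE (parr c.2), t) S
      have h2 := weight_lt_cons N (.jumpE m, parr c.2) ((.parrE (parr c.2), t) :: S)
      omega
    · have := weight_lt_of_digit_lt (y := (.jumpE m, parr c.2)) hlen (by simp [digit])
      omega

theorem Simulates.jump_to_tens (h : ParStepF p q F [] []) (hp : p.IsMLL) (hpa : p.IsAcyclic)
    (hs : Simulates p q F I N (counit m) l J S) (hc : c ∈ F) (hu : u ∈ c.1)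
    (hm : counit m ∈ p.ST) (hj : p.jump m = tens c.1) (he : .jumpE m ∉ l.map Prod.fst) :
    ∃ J' S', Simulates p q F I N u ((.jumpE m, counit m) :: l) J' S' := by
  have hcount := hs.count
  have hadj : p.Adj J (.jumpE m) (tens c.1) (counit m) := hj ▸ .symm (.jump hm)
  have hl := (hs.mono (.jumpE m, counit m)).push hadj
    (hs.edge_notMem he (not_isErased_jumpE m)) (.inl (by simp)) (fun _ => by simp)
  have htens : p.Adj J (.tensE (tens c.1) u) (tens c.1) u := .tens (h.tens_mem hc) hu
  have h1 := weight_lt_cons N (.jumpE m, counit m) S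
  have h2 := weight_lt_cons N (.tensE (tens c.1) u, tens c.1) ((.jumpE m, counit m) :: S)
  refine ⟨J, _, hl.push htens.symm (hl.notMem_of_head hpa htens (by simp))
    (.inr ⟨c, hc, by simp⟩) (absurd · (h.notMem_ST hp hc (.inl rfl))), ?_, ?_⟩
  · intro c' hc' t' S' hS
    obtain ⟨-, rfl⟩ := List.cons.inj hS
    exact .inr ⟨m, counit m, S, rfl, by simp only [List.length_cons]; omega⟩
  · simp only [List.length_cons]; omega

theorem Simulates.jump_to_parr (h : ParStepF p q F [] []) (hp : p.IsMLL) (hpa : p.IsAcyclic)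
    (hs : Simulates p q F I N (counit m) l J S) (hc : c ∈ F) (hu : u ∈ c.2)
    (hm : counit m ∈ p.ST) (hj : p.jump m = parr c.2) (he : .jumpE m ∉ l.map Prod.fst) :
    ∃ J' S', Simulates p q F I N u ((.jumpE m, counit m) :: l) J' S' := by
  have hcount := hs.count
  have hadj : p.Adj J (.jumpE m) (parr c.2) (counit m) := hj ▸ .symm (.jump hm)
  have hl := (hs.mono (.jumpE m, counit m)).push hadj
    (hs.edge_notMem he (not_isErased_jumpE m)) (.inl (by simp)) (fun _ => by simp)
  obtain ⟨J', hl'⟩ := hl.push_parr_premise h hp hc hu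
    (hl.notMem_of_head hpa (.parr (h.parr_mem hc)) (by simp))
  have h1 := weight_lt_cons N (.jumpE m, counit m) S
  have h2 := weight_lt_cons N (.parrE (parr c.2), parr c.2) ((.jumpE m, counit m) :: S)
  refine ⟨J', _, hl', by simp, ?_⟩
  simp only [List.length_cons]; omega

end Moves

theorem headI_mem_of_ne_nil {α : Type*} [Inhabited α] {l : List α} (h : l ≠ []) :
    l.headI ∈ l := by
  cases l <;> simp_all

/-- Every path of the reduct is simulated by a path of `p`. -/
theorem exists_simulates (h : ParStepF p q F [] []) (hp : p.IsMLL) (hq : q.IsMLL)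
    (hpa : p.IsAcyclic) (hqa : q.IsAcyclic) (hI : q.IsSwitching I) {N : ℕ}
    (hN : ∀ J t S, p.IsSwitching J → p.IsTrail J t S → S.length ≤ N)
    {t : Tree} {l : List (Edge × Tree)} (hl : q.IsTrail I t l) :
    ∃ J S, Simulates p q F I N t l J S := by
  induction hl with
  | nil t ht =>
    let J : Tree → Tree := fun P => if P ∈ q.ST then I P else
      match P with
      | parr ts => ts.headI
      | P => P
    refine ⟨J, [], ⟨⟨?_, fun ts hts => if_pos hts, .nil t (h.ST_subset ht), by simp, by simp⟩,
      by simp, by simp⟩⟩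
    intro ts hts
    by_cases hts' : parr ts ∈ q.ST
    · simp only [J, if_pos hts']; exact hI ts hts'
    · simp only [J, if_neg hts']; exact headI_mem_of_ne_nil (hp.2.2.1 ts hts)
  | @cons n e o l ha hl hd ih =>
    obtain ⟨J, S, hs⟩ := ih
    have he : e ∉ l.map Prod.fst := fun h => by
      obtain ⟨x, hx, hxe⟩ := List.mem_map.1 h
      exact hd x hx hxe
    rcases h.adj_cases hp ha with ⟨h1, h2⟩ | ⟨c, hc, ⟨hz, rfl⟩ | ⟨hz, rfl⟩ | ⟨m, rfl, hm, hj⟩⟩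
    · exact hs.preserved (h1 J hs.agree) he h2
    · exact hs.residual_tens h hp hpa hN hc hz (ha.mem_ST hq hI).1
        (List.nodup_cons.1 (hqa I hI _ _ (.cons ha hl hd))).1
    · exact hs.residual_parr h hp hq hpa hc hz he
    · have hF := h.hF c hc
      have h1 : c.1.headI ∈ c.1 := headI_mem_of_ne_nil hF.2.1
      have h2 : c.2.headI ∈ c.2 := headI_mem_of_ne_nil fun h' => hF.2.1 (by
        rw [← List.length_eq_zero_iff, hF.1, h', List.length_nil])
      rcases hj with ⟨hj, ⟨rfl, rfl⟩ | ⟨rfl, rfl⟩⟩ | ⟨hj, ⟨rfl, rfl⟩ | ⟨rfl, rfl⟩⟩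
      · exact hs.jump_from_tens h hp hpa hN hc h1 hm hj he
      · exact hs.jump_to_tens h hp hpa hc h1 hm hj he
      · exact hs.jump_from_parr h hp hpa hN hc h2 hm hj he
      · exact hs.jump_to_parr h hp hpa hc h2 hm hj he

end MultStep

/-- If `p` and `q` are acyclic MLL proof nets and `p ⇒m q`,
    then `ln(q) ≤ φ(ln(p))` where `φ(0) = 0` and
    `φ(n) = n + (n+1)(φ(n-1)+2)` for `n > 0`. -/
theorem mult_ln_bound (p q : Net)
    (hp : p.IsMLL) (hq : q.IsMLL) (hpa : p.IsAcyclic) (hqa : q.IsAcyclic)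
    (h : MultStep p q) :
    q.ln ≤ phi p.ln := by
  obtain ⟨F, h⟩ := h
  refine csSup_le' ?_
  rintro n ⟨I, t, l, hI, hl, rfl⟩
  obtain ⟨J, S, hs⟩ := exists_simulates h hp hq hpa hqa hI
    (fun J t S hJ hS => hS.length_le hp hpa hJ) hl
  have h1 := weight_lt_pow (hs.trail.length_le hp hpa hs.switching)
  have h2 := pow_le_phi p.ln
  have h3 := hs.count
  omega

end MLLNets
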